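/- Let d ≥ 2 and set n = d−1. The critical value map is locally onto: for every a : Fin n → ℂ and every ε > 0 there exists δ > 0 such that for every multiset M over ℂ with Multiset.card M = n for which there exist tuples f, g : Fin n → ℂ whose multisets of coordinates are cvl(p_a) and M respectively and which satisfy dist (f i) (g i) < δ for every i, there exists a' : Fin n → ℂ with dist (a' i) (a i) < ε for every i and cvl(p_{a'}) = M. (Every multiset sufficiently close to the critical value multiset of p_a is the critical value multiset of a nearby monic centered degree-d polynomial.) -/

import Mathlib

open Polynomial

/-- The monic centered polynomial `X^d + ∑_{i=0}^{d-2} (a i)·X^i` determined by the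
coefficient vector `a`. -/
noncomputable def mcPoly (d : ℕ) (a : Fin (d - 1) → ℂ) : ℂ[X] :=
  X ^ d + ∑ i : Fin (d - 1), C (a i) * X ^ (i : ℕ)

/-- The critical value multiset of a polynomial: the multiset of values of `p` at the
roots (with multiplicity) of its derivative. -/
noncomputable def cvl (p : ℂ[X]) : Multiset ℂ :=
  Multiset.map (fun z => p.eval z) p.derivative.roots

namespace MvPolynomial

theorem algebraicIndependent_of_isIntegral_adjoin {K ι : Type*} [Field K] [Finite ι]
    (F : ι → MvPolynomial ι K)
    [Algebra.IsIntegral (Algebra.adjoin K (Set.range F)) (MvPolynomial ι K)] :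
    AlgebraicIndependent K F :=
  (Algebra.IsAlgebraic.isTranscendenceBasis_of_lift_le_trdeg_of_finite K F (by simp)).1

theorem exists_monic_isRoot_iff_exists_eval {K ι : Type*} [Field K] [IsAlgClosed K] [Finite ι]
    (F : ι → MvPolynomial ι K)
    [Algebra.IsIntegral (Algebra.adjoin K (Set.range F)) (MvPolynomial ι K)]
    (b : MvPolynomial ι K) :
    ∃ q : (MvPolynomial ι K)[X], q.Monic ∧ ∀ (y : ι → K) (t : K),
      (q.map (eval y)).IsRoot t ↔ ∃ x, (fun i => eval x (F i)) = y ∧ eval x b = t := by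
  have hF := algebraicIndependent_of_isIntegral_adjoin F
  set S := Algebra.adjoin K (Set.range F)
  let e : MvPolynomial ι K ≃ₐ[K] S := hF.aevalEquiv
  have hS : IsIntegrallyClosed S := IsIntegrallyClosed.of_equiv e.toRingEquiv
  have hb : IsIntegral S b := Algebra.IsIntegral.isIntegral b
  have he (s : S) : aeval F (e.symm s) = (s : MvPolynomial ι K) := by
    rw [← hF.algebraMap_aevalEquiv]
    exact congrArg Subtype.val (e.apply_symm_apply s)
  have heval (x : ι → K) (p : MvPolynomial ι K) :
      eval x (aeval F p) = eval (fun i => eval x (F i)) p := by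
    rw [← coe_aeval_eq_eval, ← coe_aeval_eq_eval, aeval_eq_bind₁]
    exact aeval_bind₁ ..
  refine ⟨(minpoly S b).map (e.symm : S →+* MvPolynomial ι K), (minpoly.monic hb).map _,
    fun y t => ⟨fun ht => ?_, ?_⟩⟩
  · let ψ : S →+* K := (eval y).comp (e.symm : S →+* MvPolynomial ι K)
    rw [Polynomial.map_map, Polynomial.IsRoot.def, Polynomial.eval_map] at ht
    let Ψ : S[X] →+* K := eval₂RingHom ψ t
    have hΨ : Function.Surjective Ψ := fun z => ⟨Polynomial.C (algebraMap K S z), by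
      simp [Ψ, ψ]⟩
    let P : Ideal S[X] := RingHom.ker Ψ
    have : P.IsMaximal := RingHom.ker_isMaximal_of_surjective Ψ hΨ
    let : Algebra S[X] (MvPolynomial ι K) := (Polynomial.aeval b).toRingHom.toAlgebra
    have : IsScalarTower S S[X] (MvPolynomial ι K) := .of_algebraMap_eq fun s => by
      simp [RingHom.algebraMap_toAlgebra]
    have : Algebra.IsIntegral S[X] (MvPolynomial ι K) := .tower_top S
    obtain ⟨Q, hQ, hQP⟩ := Ideal.exists_ideal_over_maximal_of_isIntegral
      (R := S[X]) (S := MvPolynomial ι K) P (by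
        intro p hp
        obtain ⟨r, rfl⟩ := minpoly.isIntegrallyClosed_dvd hb (p := p) hp
        change Ψ _ = 0
        rw [map_mul]
        exact mul_eq_zero_of_left ht _)
    obtain ⟨x, rfl⟩ := isMaximal_iff_eq_vanishingIdeal_singleton.mp hQ
    have key (p : S[X]) (hp : Ψ p = 0) : eval x (Polynomial.aeval b p) = 0 := by
      have : p ∈ P := hp
      rw [← hQP] at this
      exact this x rfl
    refine ⟨x, ?_, ?_⟩
    · ext i
      have := key (Polynomial.C (e (X i) - algebraMap K S (y i))) (by simp [Ψ, ψ])
      have h2 : ((e (X i) : S) : MvPolynomial ι K) = F i := by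
        rw [← he]; simp
      simpa [sub_eq_zero, h2] using this
    · have := key (Polynomial.X - Polynomial.C (algebraMap K S t)) (by simp [Ψ, ψ])
      simpa [sub_eq_zero] using this
  · rintro ⟨x, rfl, rfl⟩
    have h : (eval fun i => eval x (F i)).comp (e.symm : S →+* MvPolynomial ι K)
        = (eval x).comp (algebraMap S (MvPolynomial ι K)) := by
      ext s
      simp only [RingHom.comp_apply, RingHom.coe_coe, ← heval, he]
      rfl
    rw [Polynomial.map_map, h, Polynomial.IsRoot.def, Polynomial.eval_map, ← Polynomial.hom_eval₂,
      ← Polynomial.aeval_def, minpoly.aeval, map_zero]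

theorem homogeneousComponent_mul_of_isHomogeneous {R σ : Type*} [CommSemiring R]
    {q : MvPolynomial σ R} {d n : ℕ} (hq : q.IsHomogeneous d) (hdn : d ≤ n)
    (p : MvPolynomial σ R) :
    homogeneousComponent n (p * q) = homogeneousComponent (n - d) p * q := by
  have hmem (k : ℕ) : homogeneousComponent k p * q ∈ homogeneousSubmodule σ R (k + d) :=
    (homogeneousComponent_isHomogeneous k p).mul hq
  conv_lhs => rw [← sum_homogeneousComponent p, Finset.sum_mul, map_sum]
  rw [Finset.sum_eq_single (n - d)]
  · rw [homogeneousComponent_of_mem (hmem _), if_pos (by omega)]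
  · intro k _ hk
    rw [homogeneousComponent_of_mem (hmem _), if_neg (by omega)]
  · intro h
    rw [homogeneousComponent_eq_zero (n - d) p (by have := Finset.mem_range.not.1 h; omega), zero_mul,
      map_zero]

theorem isIntegral_adjoin_of_isHomogeneous {K ι : Type*} [Field K] [IsAlgClosed K] [Finite ι]
    {F : ι → MvPolynomial ι K} {d : ℕ} (hd : d ≠ 0) (hF : ∀ i, (F i).IsHomogeneous d)
    (h0 : ∀ x : ι → K, (∀ i, eval x (F i) = 0) → x = 0) :
    Algebra.IsIntegral (Algebra.adjoin K (Set.range F)) (MvPolynomial ι K) := by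
  classical
  have := Fintype.ofFinite ι
  have hrad (i : ι) : (X i : MvPolynomial ι K) ∈ (Ideal.span (Set.range F)).radical := by
    rw [← vanishingIdeal_zeroLocus_eq_radical (K := K), zeroLocus_span]
    intro x hx
    rw [h0 x fun i => by simpa using hx (F i) ⟨i, rfl⟩]
    simp
  choose N' hN' using hrad
  obtain ⟨N, hdN, hN⟩ : ∃ N, d ≤ N ∧ ∀ i, (X i : MvPolynomial ι K) ^ N ∈
      Ideal.span (Set.range F) := by
    refine ⟨d + ∑ i, N' i, by omega, fun i => Ideal.mem_of_dvd _ (pow_dvd_pow _ ?_) (hN' i)⟩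
    exact (Finset.single_le_sum (f := N') (fun _ _ => Nat.zero_le _) (Finset.mem_univ i)).trans
      (by omega)
  have hhom (i : ι) : ∃ g : ι → MvPolynomial ι K, (∀ j, (g j).IsHomogeneous (N - d)) ∧
      X i ^ N = ∑ j, g j * F j := by
    obtain ⟨c, hc⟩ := Ideal.mem_span_range_iff_exists_fun.1 (hN i)
    refine ⟨fun j => homogeneousComponent (N - d) (c j),
      fun j => homogeneousComponent_isHomogeneous _ _, ?_⟩
    have h1 : homogeneousComponent N (X i ^ N : MvPolynomial ι K) = X i ^ N := by
      rw [homogeneousComponent_of_mem (isHomogeneous_X_pow i N), if_pos rfl]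
    rw [← h1, ← hc, map_sum]
    exact Finset.sum_congr rfl fun j _ => homogeneousComponent_mul_of_isHomogeneous (hF j) hdN _
  choose g hg hgN using hhom
  let S := Algebra.adjoin K (Set.range F)
  let B : Set (MvPolynomial ι K) :=
    (fun m : ι →₀ ℕ => monomial m 1) '' {m | ∀ i, m i < N}
  have hB : B.Finite := by
    refine Set.Finite.image _ ?_
    refine (Set.Finite.preimage DFunLike.coe_injective.injOn
      (Set.Finite.pi' fun _ : ι => Set.finite_Iio N)).subset fun m hm => hm
  have hmem (p : MvPolynomial ι K) (hp : ∀ v ∈ p.support,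
      (monomial v 1 : MvPolynomial ι K) ∈ Submodule.span S B) : p ∈ Submodule.span S B := by
    rw [p.as_sum]
    refine Submodule.sum_mem _ fun v hv => ?_
    have : monomial v (coeff v p) = algebraMap K S (coeff v p) •
        (monomial v 1 : MvPolynomial ι K) := by
      rw [algebraMap_smul, smul_monomial, smul_eq_mul, mul_one]
    rw [this]
    exact Submodule.smul_mem _ _ (hp v hv)
  have hspan : ∀ n, ∀ m : ι →₀ ℕ, m.degree = n →
      (monomial m 1 : MvPolynomial ι K) ∈ Submodule.span S B := by
    intro n
    induction n using Nat.strong_induction_on with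
    | _ n ih =>
    intro m hm
    by_cases hmN : ∀ i, m i < N
    · exact Submodule.subset_span ⟨m, hmN, rfl⟩
    push Not at hmN
    obtain ⟨i, hi⟩ := hmN
    have hle : Finsupp.single i N ≤ m := by simpa using hi
    have hmon : (monomial m 1 : MvPolynomial ι K) =
        ∑ j, (⟨F j, Algebra.subset_adjoin ⟨j, rfl⟩⟩ : S) •
          (g i j * monomial (m - Finsupp.single i N) 1) := by
      conv_lhs => rw [← add_tsub_cancel_of_le hle]
      rw [← one_mul (1 : K), ← monomial_mul, ← X_pow_eq_monomial, hgN i, Finset.sum_mul, one_mul]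
      refine Finset.sum_congr rfl fun j _ => ?_
      rw [Subalgebra.smul_def, smul_eq_mul]
      ring
    rw [hmon]
    refine Submodule.sum_mem _ fun j _ => Submodule.smul_mem _ _ ?_
    have hdeg := congrArg Finsupp.degree (add_tsub_cancel_of_le hle)
    rw [map_add, Finsupp.degree_single] at hdeg
    refine hmem _ fun v hv => ih v.degree ?_ v rfl
    have := ((hg i j).mul (isHomogeneous_monomial (1 : K) rfl)).coeff_eq_zero.mt
      (mem_support_iff.1 hv)
    omega
  have hfin : Module.Finite S (MvPolynomial ι K) := by
    refine ⟨⟨hB.toFinset, ?_⟩⟩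
    rw [hB.coe_toFinset, eq_top_iff]
    exact fun p _ => hmem p fun v _ => hspan _ v rfl
  exact Algebra.IsIntegral.of_finite S _

open Filter Topology

theorem eventually_exists_isRoot_dist_lt {ι : Type*} {q : (MvPolynomial ι ℂ)[X]} (hq : q.Monic)
    {y₀ : ι → ℂ} {t₀ : ℂ} (ht₀ : (q.map (eval y₀)).IsRoot t₀) {η : ℝ} (hη : 0 < η) :
    ∀ᶠ y in 𝓝 y₀, ∃ t, (q.map (eval y)).IsRoot t ∧ dist t t₀ < η := by
  have hev (y : ι → ℂ) : (q.map (eval y)).eval t₀ = eval y (q.eval (C t₀)) := by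
    rw [← Polynomial.eval₂_at_apply, Polynomial.eval_map, eval_C]
  have hcont : Continuous fun y : ι → ℂ => ‖(q.map (eval y)).eval t₀‖ := by
    simp only [hev]
    exact (continuous_eval _).norm
  have hlim := hcont.tendsto y₀
  rw [ht₀.eq_zero, norm_zero] at hlim
  filter_upwards [hlim.eventually_lt_const (pow_pos hη q.natDegree)] with y hy
  by_contra! h
  refine hy.not_ge ?_
  have hm : (q.map (eval y)).Monic := hq.map _
  have hs := IsAlgClosed.splits (q.map (eval y))
  have hprod : ∀ s : Multiset ℂ, (∀ t ∈ s, η ≤ dist t t₀) →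
      η ^ s.card ≤ ‖((s.map fun t => Polynomial.X - Polynomial.C t).prod).eval t₀‖ := by
    intro s
    induction s using Multiset.induction_on with
    | empty => simp
    | cons a s ih =>
      intro hs
      rw [Multiset.forall_mem_cons, dist_comm, dist_eq_norm] at hs
      simp only [Multiset.card_cons, Multiset.map_cons, Multiset.prod_cons, Polynomial.eval_mul,
        Polynomial.eval_sub, Polynomial.eval_X, Polynomial.eval_C, norm_mul, pow_succ']
      exact mul_le_mul hs.1 (ih hs.2) (by positivity) (norm_nonneg _)
  rw [hs.eq_prod_roots_of_monic hm, ← hq.natDegree_map (eval y), hs.natDegree_eq_card_roots]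
  exact hprod _ fun t ht => h t (Polynomial.isRoot_of_mem_roots ht)

theorem eventually_norm_le_of_isRoot {ι : Type*} {q : (MvPolynomial ι ℂ)[X]} (hq : q.Monic)
    (y₀ : ι → ℂ) : ∃ R : ℝ, ∀ᶠ y in 𝓝 y₀, ∀ t, (q.map (eval y)).IsRoot t → ‖t‖ ≤ R := by
  have hcont : Continuous fun y : ι → ℂ => (q.map (eval y)).cauchyBound := by
    simp only [Polynomial.cauchyBound, (hq.map (eval _)).leadingCoeff, hq.natDegree_map,
      Polynomial.coeff_map, nnnorm_one, div_one]
    exact (Continuous.finset_sup_apply fun k _ => (continuous_eval _).nnnorm).add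
      continuous_const
  refine ⟨(q.map (eval y₀)).cauchyBound + 1, ?_⟩
  filter_upwards [(hcont.tendsto y₀).eventually_lt_const (lt_add_one _)] with y hy t ht
  exact_mod_cast ((ht.norm_lt_cauchyBound (hq.map _).ne_zero).trans hy).le

theorem isOpenMap_eval_of_isIntegral_adjoin {ι : Type*} [Finite ι] (F : ι → MvPolynomial ι ℂ)
    [Algebra.IsIntegral (Algebra.adjoin ℂ (Set.range F)) (MvPolynomial ι ℂ)] :
    IsOpenMap fun (x : ι → ℂ) i => eval x (F i) := by
  have := Fintype.ofFinite ι
  set Φ : (ι → ℂ) → ι → ℂ := fun x i => eval x (F i)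
  have hΦ : Continuous Φ := continuous_pi fun i => continuous_eval _
  choose q hqm hq using exists_monic_isRoot_iff_exists_eval F
  have hcoord (x : ι → ℂ) (i : ι) : ((q (X i)).map (eval (Φ x))).IsRoot (x i) :=
    (hq (X i) _ _).2 ⟨x, rfl, eval_X i⟩
  rw [isOpenMap_iff_nhds_le]
  intro x₀ s hs
  obtain ⟨U, hUs, hU, hxU⟩ := mem_nhds_iff.1 (mem_map.1 hs)
  have hfin : {x | Φ x = Φ x₀ ∧ x ≠ x₀}.Finite := by
    refine Set.Finite.subset (Set.Finite.pi' fun i =>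
      (((q (X i)).map (eval (Φ x₀))).roots.toFinset).finite_toSet) ?_
    intro x hx i
    have := hcoord x i
    rw [hx.1] at this
    simpa [((hqm (X i)).map (eval (Φ x₀))).ne_zero] using this
  obtain ⟨b, hb₀, hb⟩ : ∃ b : MvPolynomial ι ℂ, eval x₀ b ≠ 0 ∧
      ∀ x, Φ x = Φ x₀ → x ≠ x₀ → eval x b = 0 := by
    have (x : ι → ℂ) : ∃ p : MvPolynomial ι ℂ, x ≠ x₀ → eval x p = 0 ∧ eval x₀ p ≠ 0 := by
      by_cases h : x = x₀
      · exact ⟨0, fun hne => absurd h hne⟩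
      · obtain ⟨i, hi⟩ := Function.ne_iff.1 h
        exact ⟨X i - C (x i), fun _ => by simpa [sub_eq_zero] using hi.symm⟩
    choose p hp using this
    refine ⟨∏ x ∈ hfin.toFinset, p x, ?_, fun x hx hne => ?_⟩
    · rw [eval_prod, Finset.prod_ne_zero_iff]
      exact fun x hx => (hp x (hfin.mem_toFinset.1 hx).2).2
    · rw [eval_prod]
      exact Finset.prod_eq_zero (hfin.mem_toFinset.2 ⟨hx, hne⟩) (hp x hne).1
  choose R hR using fun i => eventually_norm_le_of_isRoot (hqm (X i)) (Φ x₀)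
  let T : Set (ι → ℂ) := (Set.univ.pi fun i => Metric.closedBall 0 (R i)) \ U
  have hT : IsCompact T := (isCompact_univ_pi fun i => isCompact_closedBall _ _).diff hU
  obtain ⟨η, hη, hηT⟩ : ∃ η > 0, ∀ x ∈ T, η ≤ dist (eval x b) (eval x₀ b) + dist (Φ x) (Φ x₀) := by
    refine hT.exists_forall_le' (a := 0) ?_ fun x hx => ?_
    · exact (((continuous_eval b).dist continuous_const).add
        (hΦ.dist continuous_const)).continuousOn
    · by_cases h : Φ x = Φ x₀
      · have hne : x ≠ x₀ := by rintro rfl; exact hx.2 hxU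
        rw [hb x h hne]
        have := dist_pos.2 hb₀.symm
        positivity
      · have := dist_pos.2 h
        positivity
  have hroot : ((q b).map (eval (Φ x₀))).IsRoot (eval x₀ b) := (hq b _ _).2 ⟨x₀, rfl, rfl⟩
  filter_upwards [eventually_exists_isRoot_dist_lt (hqm b) hroot (half_pos hη),
    eventually_all.2 hR, Metric.ball_mem_nhds _ (half_pos hη)] with y ⟨t, ht, htd⟩ hbd hyd
  obtain ⟨x, rfl, rfl⟩ := (hq b y t).1 ht
  refine hUs (a := x) ?_
  by_contra hxU'
  have := hηT x ⟨fun i _ => ?_, hxU'⟩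
  · rw [Metric.mem_ball] at hyd
    linarith
  · simpa using hbd i _ (hcoord x i)

end MvPolynomial

theorem exists_perm_eq_comp_of_map_univ_eq {ι α : Type*} [Fintype ι] {f g : ι → α}
    (h : Multiset.map f Finset.univ.val = Multiset.map g Finset.univ.val) :
    ∃ σ : Equiv.Perm ι, f = g ∘ σ := by
  classical
  have hcard (v : α) : Nonempty ({i // f i = v} ≃ {i // g i = v}) := by
    have := congrArg (Multiset.count v) h
    rw [Multiset.count_map, Multiset.count_map] at this
    refine Fintype.card_eq.1 ?_
    simpa only [eq_comm (a := v), Fintype.card_subtype, Finset.card_def, Finset.filter_val]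
      using this
  exact ⟨Equiv.ofFiberEquiv fun v => (hcard v).some,
    funext fun i => (Equiv.ofFiberEquiv_map (fun v => (hcard v).some) i).symm⟩

theorem isHomogeneous_coeff_prod_X_sub_C {R ι : Type*} [CommRing R] [Fintype ι] {k : ℕ}
    (hk : k ≤ Fintype.card ι) :
    ((∏ j : ι, (X - C (MvPolynomial.X j : MvPolynomial ι R))).coeff k).IsHomogeneous
      (Fintype.card ι - k) := by
  have h := Multiset.prod_X_sub_C_coeff
    ((Finset.univ : Finset ι).val.map (MvPolynomial.X : ι → MvPolynomial ι R)) (k := k) (by simpa)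
  rw [Multiset.map_map, Finset.esymm_map_val, Multiset.card_map] at h
  change (∏ j : ι, (X - C (MvPolynomial.X j : MvPolynomial ι R))).coeff k = _ at h
  rw [h, ← map_one MvPolynomial.C, ← map_neg, ← map_pow]
  refine MvPolynomial.IsHomogeneous.C_mul (MvPolynomial.IsHomogeneous.sum _ _ _ fun t ht => ?_) _
  have := MvPolynomial.IsHomogeneous.prod t (fun j => (MvPolynomial.X j : MvPolynomial ι R))
    (fun _ => 1) fun j _ => MvPolynomial.isHomogeneous_X R j
  rw [Finset.sum_const, smul_eq_mul, mul_one, (Finset.mem_powersetCard.1 ht).2] at this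
  exact this

section ofCritical

variable {R S ι : Type*} [CommRing R] [Algebra ℂ R] [CommRing S] [Algebra ℂ S] [Fintype ι]

/-- The monic polynomial without constant term whose critical points are the `c j`. -/
noncomputable def ofCritical (c : ι → R) : R[X] :=
  ∑ k ∈ Finset.range (Fintype.card ι + 1),
    C (algebraMap ℂ R ((Fintype.card ι + 1) / (k + 1)) * (∏ j, (X - C (c j))).coeff k) *
      X ^ (k + 1)

theorem map_ofCritical (f : R →ₐ[ℂ] S) (c : ι → R) :
    (ofCritical c).map (f : R →+* S) = ofCritical fun j => f (c j) := by
  simp only [ofCritical, Polynomial.map_sum, Polynomial.map_mul, Polynomial.map_C,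
    Polynomial.map_pow, Polynomial.map_X, map_mul, RingHom.coe_coe, AlgHom.commutes]
  refine Finset.sum_congr rfl fun k _ => ?_
  have : (∏ j, (X - C (f (c j)))) = (∏ j, (X - C (c j))).map (f : R →+* S) := by
    simp [Polynomial.map_prod]
  rw [this, Polynomial.coeff_map, RingHom.coe_coe]

theorem eval_zero_ofCritical (c : ι → R) : (ofCritical c).eval 0 = 0 := by
  simp [ofCritical, eval_finsetSum]

theorem isHomogeneous_eval_ofCritical (i : ι) :
    ((ofCritical (MvPolynomial.X : ι → MvPolynomial ι ℂ)).eval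
      (MvPolynomial.X i)).IsHomogeneous (Fintype.card ι + 1) := by
  simp only [ofCritical, eval_finsetSum, eval_mul, eval_C, eval_pow, eval_X]
  refine MvPolynomial.IsHomogeneous.sum _ _ _ fun k hk => ?_
  have hk' : k ≤ Fintype.card ι := Nat.lt_succ_iff.1 (Finset.mem_range.1 hk)
  have := ((isHomogeneous_coeff_prod_X_sub_C (R := ℂ) hk').C_mul
    (((Fintype.card ι : ℂ) + 1) / (k + 1))).mul (MvPolynomial.isHomogeneous_X_pow i (k + 1))
  rwa [show Fintype.card ι - k + (k + 1) = Fintype.card ι + 1 by omega] at this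

theorem derivative_ofCritical (c : ι → ℂ) :
    (ofCritical c).derivative = C ((Fintype.card ι : ℂ) + 1) * ∏ j, (X - C (c j)) := by
  have hdeg : (∏ j, (X - C (c j))).natDegree = Fintype.card ι := by simp
  rw [as_sum_range_C_mul_X_pow (∏ j, (X - C (c j))), hdeg, Finset.mul_sum]
  rw [ofCritical, derivative_sum]
  refine Finset.sum_congr rfl fun k _ => ?_
  rw [derivative_C_mul_X_pow, ← mul_assoc, ← C_mul, Nat.add_sub_cancel]
  have : (k : ℂ) + 1 ≠ 0 := Nat.cast_add_one_ne_zero k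
  congr 2
  push_cast
  field_simp

theorem eq_ofCritical {p : ℂ[X]} {c : ι → ℂ} (h0 : p.eval 0 = 0)
    (hp : p.derivative = C ((Fintype.card ι : ℂ) + 1) * ∏ j, (X - C (c j))) :
    p = ofCritical c := by
  have h : (p - ofCritical c).derivative = 0 := by
    rw [derivative_sub, hp, derivative_ofCritical, sub_self]
  rw [← sub_eq_zero, eq_C_of_natDegree_eq_zero (derivative_eq_zero.1 h), coeff_zero_eq_eval_zero,
    eval_sub, h0, eval_zero_ofCritical, sub_self, C_0]

theorem natDegree_ofCritical (c : ι → ℂ) : (ofCritical c).natDegree = Fintype.card ι + 1 := by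
  have h : (ofCritical c).derivative.natDegree = Fintype.card ι := by
    rw [derivative_ofCritical, natDegree_C_mul (Nat.cast_add_one_ne_zero _)]
    simp
  have h0 : (ofCritical c).natDegree ≠ 0 := fun h0 => by
    have := (derivative_ofCritical c).symm.trans (derivative_eq_zero.2 h0)
    exact mul_ne_zero (C_ne_zero.2 (Nat.cast_add_one_ne_zero _))
      (monic_prod_X_sub_C c _).ne_zero this
  rw [natDegree_derivative] at h
  omega

theorem monic_ofCritical (c : ι → ℂ) : (ofCritical c).Monic := by
  have h := leadingCoeff_derivative (ofCritical c)
  rw [derivative_ofCritical, leadingCoeff_mul, leadingCoeff_C,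
    (monic_prod_X_sub_C c Finset.univ).leadingCoeff, natDegree_ofCritical, mul_one] at h
  have hn : (Fintype.card ι : ℂ) + 1 ≠ 0 := Nat.cast_add_one_ne_zero _
  refine mul_right_cancel₀ hn ?_
  push_cast at h
  rw [one_mul, ← h]

theorem roots_derivative_ofCritical (c : ι → ℂ) :
    (ofCritical c).derivative.roots = Finset.univ.val.map c := by
  rw [derivative_ofCritical, roots_C_mul _ (Nat.cast_add_one_ne_zero _)]
  exact (congrArg roots (by simp)).trans (roots_multiset_prod_X_sub_C (Finset.univ.val.map c))

theorem eq_zero_of_eval_ofCritical_eq_zero {c : ι → ℂ}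
    (h : ∀ i, (ofCritical c).eval (c i) = 0) : c = 0 := by
  classical
  set p := ofCritical c
  have hp0 : p ≠ 0 := (monic_ofCritical c).ne_zero
  have hp'0 : p.derivative ≠ 0 := by
    rw [derivative_ofCritical]
    exact mul_ne_zero (C_ne_zero.2 (Nat.cast_add_one_ne_zero _))
      (monic_prod_X_sub_C c _).ne_zero
  have hmem (z : ℂ) (hz : z ∈ p.derivative.roots) : z ∈ p.roots := by
    rw [roots_derivative_ofCritical] at hz
    obtain ⟨i, -, rfl⟩ := Multiset.mem_map.1 hz
    exact (mem_roots hp0).2 (h i)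
  have hcount : ∀ z ∈ p.roots.toFinset, p.roots.count z = p.derivative.roots.count z + 1 := by
    intro z hz
    have hz' : p.IsRoot z := isRoot_of_mem_roots (Multiset.mem_toFinset.1 hz)
    have := (rootMultiplicity_pos hp0).2 hz'
    rw [count_roots, count_roots, derivative_rootMultiplicity_of_root hz']
    omega
  have hcard : p.roots.card = Fintype.card ι + 1 := by
    rw [IsAlgClosed.card_roots_eq_natDegree, natDegree_ofCritical]
  have hcard' : p.derivative.roots.card = Fintype.card ι := by
    rw [roots_derivative_ofCritical]
    simp
  rw [← Multiset.toFinset_sum_count_eq, Finset.sum_congr rfl hcount, Finset.sum_add_distrib,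
    Multiset.sum_count_eq_card fun z hz => Multiset.mem_toFinset.2 (hmem z hz), hcard'] at hcard
  have hone : p.roots.toFinset.card ≤ 1 := by
    rw [Finset.sum_const, smul_eq_mul, mul_one] at hcard
    omega
  have hzero : (0 : ℂ) ∈ p.roots.toFinset :=
    Multiset.mem_toFinset.2 ((mem_roots hp0).2 (eval_zero_ofCritical c))
  funext i
  exact Finset.card_le_one.1 hone _ (Multiset.mem_toFinset.2 ((mem_roots hp0).2 (h i))) _ hzero

theorem coeff_card_eq_zero_iff_sum_eq_zero [Nonempty ι] {p : ℂ[X]} {z : ι → ℂ}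
    (hp : p.derivative = C ((Fintype.card ι : ℂ) + 1) * ∏ j, (X - C (z j))) :
    p.coeff (Fintype.card ι) = 0 ↔ ∑ j, z j = 0 := by
  have hn : Fintype.card ι - 1 + 1 = Fintype.card ι := Nat.sub_add_cancel Fintype.card_pos
  have h := coeff_derivative p (Fintype.card ι - 1)
  have h2 := prod_X_sub_C_coeff_card_pred Finset.univ z Fintype.card_pos
  rw [Finset.card_univ] at h2
  rw [hp, coeff_C_mul, h2, ← Nat.cast_add_one, ← Nat.cast_add_one, hn] at h
  have h3 : ((Fintype.card ι + 1 : ℕ) : ℂ) ≠ 0 := Nat.cast_ne_zero.2 (Nat.succ_ne_zero _)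
  have h4 : (Fintype.card ι : ℂ) ≠ 0 := Nat.cast_ne_zero.2 Fintype.card_ne_zero
  rw [← mul_eq_zero_iff_right h4, ← h, mul_eq_zero_iff_left h3, neg_eq_zero]

/-- The translate of `ofCritical c` whose critical points have sum zero. -/
noncomputable def centeredOfCritical (c : ι → R) : R[X] :=
  (ofCritical c).comp (X + C (algebraMap ℂ R (Fintype.card ι)⁻¹ * ∑ j, c j))

theorem map_centeredOfCritical (f : R →ₐ[ℂ] S) (c : ι → R) :
    (centeredOfCritical c).map (f : R →+* S) = centeredOfCritical fun j => f (c j) := by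
  simp [centeredOfCritical, Polynomial.map_comp, map_ofCritical, Polynomial.map_sum]

theorem continuous_coeff_centeredOfCritical (k : ℕ) :
    Continuous fun c : ι → ℂ => (centeredOfCritical c).coeff k := by
  have h (c : ι → ℂ) : (centeredOfCritical c).coeff k =
      MvPolynomial.eval c ((centeredOfCritical MvPolynomial.X).coeff k) := by
    have := map_centeredOfCritical (MvPolynomial.aeval c) (MvPolynomial.X : ι → MvPolynomial ι ℂ)
    simp only [MvPolynomial.aeval_X] at this
    rw [← this, Polynomial.coeff_map, ← MvPolynomial.coe_aeval_eq_eval]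
  simp only [h]
  exact MvPolynomial.continuous_eval _

theorem derivative_centeredOfCritical (c : ι → ℂ) :
    (centeredOfCritical c).derivative = C ((Fintype.card ι : ℂ) + 1) *
      ∏ j, (X - C (c j - (Fintype.card ι : ℂ)⁻¹ * ∑ j, c j)) := by
  have h (z m : ℂ) : X + C m - C z = X - C (z - m) := by
    rw [C_sub]
    ring
  rw [centeredOfCritical, Algebra.algebraMap_self, RingHom.id_apply]
  generalize (Fintype.card ι : ℂ)⁻¹ * ∑ j, c j = m
  simp [derivative_comp, derivative_ofCritical, Polynomial.prod_comp, h]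

theorem cvl_centeredOfCritical (c : ι → ℂ) :
    cvl (centeredOfCritical c) = Finset.univ.val.map fun j => (ofCritical c).eval (c j) := by
  have h : (centeredOfCritical c).derivative.roots =
      Finset.univ.val.map fun j => c j - (Fintype.card ι : ℂ)⁻¹ * ∑ j, c j := by
    rw [derivative_centeredOfCritical, ← derivative_ofCritical, roots_derivative_ofCritical]
  rw [cvl, h, Multiset.map_map, centeredOfCritical, Algebra.algebraMap_self, RingHom.id_apply]
  generalize (Fintype.card ι : ℂ)⁻¹ * ∑ j, c j = m
  simp

theorem monic_centeredOfCritical (c : ι → ℂ) : (centeredOfCritical c).Monic :=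
  (monic_ofCritical c).comp_X_add_C _

theorem natDegree_centeredOfCritical (c : ι → ℂ) :
    (centeredOfCritical c).natDegree = Fintype.card ι + 1 := by
  rw [centeredOfCritical, natDegree_comp, natDegree_ofCritical, natDegree_X_add_C, mul_one]

theorem coeff_card_centeredOfCritical [Nonempty ι] (c : ι → ℂ) :
    (centeredOfCritical c).coeff (Fintype.card ι) = 0 := by
  rw [coeff_card_eq_zero_iff_sum_eq_zero (derivative_centeredOfCritical c),
    Finset.sum_sub_distrib, Finset.sum_const, Finset.card_univ, nsmul_eq_mul,
    mul_inv_cancel_left₀ (Nat.cast_ne_zero.2 Fintype.card_ne_zero), sub_self]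

theorem exists_centeredOfCritical_eq [Nonempty ι] {p : ℂ[X]} (hp : p.Monic)
    (hdeg : p.natDegree = Fintype.card ι + 1) (hcoeff : p.coeff (Fintype.card ι) = 0) :
    ∃ c : ι → ℂ, centeredOfCritical c = p := by
  obtain ⟨r, hr⟩ := IsAlgClosed.exists_root p (by
    rw [degree_eq_natDegree hp.ne_zero, hdeg]
    exact Nat.cast_ne_zero.2 (Nat.succ_ne_zero _))
  have hsplit := IsAlgClosed.splits p.derivative
  have hcard : p.derivative.roots.card = Fintype.card ι := by
    rw [IsAlgClosed.card_roots_eq_natDegree, natDegree_derivative, hdeg, Nat.add_sub_cancel]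
  obtain ⟨z, hz⟩ : ∃ z : ι → ℂ, Finset.univ.val.map z = p.derivative.roots := by
    generalize p.derivative.roots = s at hcard
    obtain ⟨l, rfl⟩ := Quot.exists_rep s
    let e : ι ≃ Fin l.length := Fintype.equivFinOfCardEq hcard.symm
    refine ⟨l.get ∘ e, ?_⟩
    rw [← Multiset.map_map, Multiset.map_univ_val_equiv, Fin.univ_val_map, List.ofFn_get]
    rfl
  have hderiv : p.derivative = C ((Fintype.card ι : ℂ) + 1) * ∏ j, (X - C (z j)) := by
    rw [hsplit.eq_prod_roots, ← hz, Multiset.map_map, leadingCoeff_derivative, hp.leadingCoeff,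
      hdeg]
    simp
  have hsum := (coeff_card_eq_zero_iff_sum_eq_zero hderiv).1 hcoeff
  have hq : p.comp (X + C r) = ofCritical fun j => z j - r := by
    refine eq_ofCritical (by simpa using hr) ?_
    have h (w : ℂ) : X + C r - C w = X - C (w - r) := by
      rw [C_sub]
      ring
    simp [derivative_comp, hderiv, Polynomial.prod_comp, h]
  refine ⟨fun j => z j - r, ?_⟩
  have hm : (Fintype.card ι : ℂ)⁻¹ * ∑ j, (z j - r) = -r := by
    rw [Finset.sum_sub_distrib, hsum, Finset.sum_const, Finset.card_univ, nsmul_eq_mul, zero_sub,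
      mul_neg, inv_mul_cancel_left₀ (Nat.cast_ne_zero.2 Fintype.card_ne_zero)]
  rw [centeredOfCritical, ← hq, comp_assoc, Algebra.algebraMap_self, RingHom.id_apply, hm]
  simp

end ofCritical

theorem degree_sum_C_mul_X_pow_lt {d : ℕ} (a : Fin (d - 1) → ℂ) :
    (∑ i : Fin (d - 1), C (a i) * X ^ (i : ℕ)).degree < (d : WithBot ℕ) :=
  (degree_sum_fin_lt _).trans_le (Nat.cast_le.2 (Nat.sub_le d 1))

theorem monic_mcPoly {d : ℕ} (a : Fin (d - 1) → ℂ) : (mcPoly d a).Monic :=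
  monic_X_pow_add (degree_sum_C_mul_X_pow_lt a)

theorem natDegree_mcPoly {d : ℕ} (a : Fin (d - 1) → ℂ) : (mcPoly d a).natDegree = d := by
  refine natDegree_eq_of_degree_eq_some ?_
  rw [mcPoly, degree_add_eq_left_of_degree_lt, degree_X_pow]
  rw [degree_X_pow]
  exact degree_sum_C_mul_X_pow_lt a

theorem coeff_mcPoly_sub_one {d : ℕ} (hd : 2 ≤ d) (a : Fin (d - 1) → ℂ) :
    (mcPoly d a).coeff (d - 1) = 0 := by
  rw [mcPoly, coeff_add, coeff_X_pow, if_neg (by omega), zero_add]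
  exact coeff_eq_zero_of_degree_lt (degree_sum_fin_lt _)

theorem coeff_mcPoly_fin {d : ℕ} (a : Fin (d - 1) → ℂ) (i : Fin (d - 1)) :
    (mcPoly d a).coeff i = a i := by
  have := i.isLt
  rw [mcPoly, coeff_add, coeff_X_pow, if_neg (by omega), zero_add, finsetSum_coeff]
  simp [coeff_C_mul, coeff_X_pow, Fin.val_inj]

theorem mcPoly_coeff {d : ℕ} (hd : 2 ≤ d) {p : ℂ[X]} (hp : p.Monic) (hdeg : p.natDegree = d)
    (hcoeff : p.coeff (d - 1) = 0) : mcPoly d (fun i => p.coeff i) = p := by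
  obtain ⟨n, rfl⟩ : ∃ n, d = n + 1 := ⟨d - 1, by omega⟩
  conv_rhs => rw [hp.as_sum, hdeg, Finset.sum_range_succ]
  rw [Nat.add_sub_cancel] at hcoeff
  rw [hcoeff, C_0, zero_mul, add_zero, mcPoly]
  exact congrArg _ (Fin.sum_univ_eq_sum_range (fun i => C (p.coeff i) * X ^ i) n)

theorem isOpenMap_eval_ofCritical {ι : Type*} [Fintype ι] :
    IsOpenMap fun (c : ι → ℂ) i => (ofCritical c).eval (c i) := by
  let F : ι → MvPolynomial ι ℂ := fun i => (ofCritical MvPolynomial.X).eval (MvPolynomial.X i)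
  have hF (c : ι → ℂ) (i : ι) : MvPolynomial.eval c (F i) = (ofCritical c).eval (c i) := by
    have := map_ofCritical (MvPolynomial.aeval c) (MvPolynomial.X : ι → MvPolynomial ι ℂ)
    simp only [MvPolynomial.aeval_X] at this
    rw [← this, ← MvPolynomial.coe_aeval_eq_eval, eval_map]
    conv_rhs => rw [← MvPolynomial.aeval_X (R := ℂ) c i]
    exact (eval₂_at_apply ((MvPolynomial.aeval c : MvPolynomial ι ℂ →ₐ[ℂ] ℂ) :
      MvPolynomial ι ℂ →+* ℂ) _).symm
  have := MvPolynomial.isIntegral_adjoin_of_isHomogeneous (F := F) (Nat.succ_ne_zero _)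
    isHomogeneous_eval_ofCritical fun c hc =>
      eq_zero_of_eval_ofCritical_eq_zero fun i => (hF c i).symm.trans (hc i)
  simpa only [hF] using MvPolynomial.isOpenMap_eval_of_isIntegral_adjoin F

/-- The critical value map is locally onto: every multiset sufficiently close to the
critical value multiset of `p_a` is the critical value multiset of a nearby monic
centered degree-`d` polynomial. -/
theorem stmt_13 (d : ℕ) (hd : 2 ≤ d) (a : Fin (d - 1) → ℂ) (ε : ℝ) (hε : 0 < ε) :
    ∃ δ > 0, ∀ M : Multiset ℂ, Multiset.card M = d - 1 →
      (∃ f g : Fin (d - 1) → ℂ,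
        Multiset.map f Finset.univ.val = cvl (mcPoly d a) ∧
        Multiset.map g Finset.univ.val = M ∧
        ∀ i, dist (f i) (g i) < δ) →
      ∃ a' : Fin (d - 1) → ℂ, (∀ i, dist (a' i) (a i) < ε) ∧
        cvl (mcPoly d a') = M := by
  have : Nonempty (Fin (d - 1)) := ⟨⟨0, by omega⟩⟩
  have hcard : Fintype.card (Fin (d - 1)) + 1 = d := by
    rw [Fintype.card_fin]
    omega
  have hcenter (c : Fin (d - 1) → ℂ) :
      mcPoly d (fun i => (centeredOfCritical c).coeff i) = centeredOfCritical c :=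
    mcPoly_coeff hd (monic_centeredOfCritical c) ((natDegree_centeredOfCritical c).trans hcard)
      (by simpa using coeff_card_centeredOfCritical c)
  obtain ⟨c, hc⟩ := exists_centeredOfCritical_eq (ι := Fin (d - 1)) (monic_mcPoly a)
    ((natDegree_mcPoly a).trans hcard.symm)
    (by simpa using coeff_mcPoly_sub_one hd a)
  have hcont : Continuous fun (c : Fin (d - 1) → ℂ) (i : Fin (d - 1)) =>
      (centeredOfCritical c).coeff i :=
    continuous_pi fun i => continuous_coeff_centeredOfCritical i
  have hnhds := isOpenMap_eval_ofCritical.image_mem_nhds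
    (hcont.continuousAt.preimage_mem_nhds (Metric.ball_mem_nhds (x := _) hε) :
      _ ∈ nhds c)
  obtain ⟨δ, hδ, hball⟩ := Metric.mem_nhds_iff.1 hnhds
  refine ⟨δ, hδ, ?_⟩
  rintro M - ⟨f, g, hf, rfl, hfg⟩
  rw [← hc, cvl_centeredOfCritical] at hf
  obtain ⟨σ, rfl⟩ := exists_perm_eq_comp_of_map_univ_eq hf
  obtain ⟨c', hc', hgc'⟩ := hball (a := g ∘ σ.symm) (by
    rw [Metric.mem_ball, dist_pi_lt_iff hδ]
    intro i
    simpa [dist_comm] using hfg (σ.symm i))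
  refine ⟨fun i => (centeredOfCritical c').coeff i, fun i => ?_, ?_⟩
  · have := (dist_pi_lt_iff hε).1 hc' i
    simpa [hc, coeff_mcPoly_fin] using this
  · rw [hcenter, cvl_centeredOfCritical]
    change Finset.univ.val.map ((fun (c : Fin (d - 1) → ℂ) i => (ofCritical c).eval (c i)) c') = _
    rw [hgc', ← Multiset.map_map, Multiset.map_univ_val_equiv]
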